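/- Let B be the tree on vertices {v, v_1, v_2, v_3, v_4} with edges vv_2, vv_3, v_1v_2, v_3v_4. Consider the cordiality game played only on the four vertices {v_1, v_2, v_3, v_4} (the vertex v is not playable and receives an arbitrary label in {0,1}). In each of the three variants (Admirable moves first; Impish moves first; Impish moves first and may pass once), Admirable has a strategy guaranteeing that, for either label of v, the discrepancy |e_1 − e_0| computed over the four edges of B is at most 2. -/

import Mathlib

open Finset

variable {V : Type} [Fintype V] [DecidableEq V]

/-- The number of edges of `G` with exactly one endpoint in `S`
(each such edge is counted once, as the ordered pair whose first
coordinate lies in `S`). This is the cut function `φ`. -/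
def cutSize (G : SimpleGraph V) [DecidableRel G.Adj] (S : Finset V) : ℕ :=
  ((univ ×ˢ univ).filter (fun p : V × V => G.Adj p.1 p.2 ∧ p.1 ∈ S ∧ p.2 ∉ S)).card

/-- The number of edges of `G`. -/
def edgeCount (G : SimpleGraph V) [DecidableRel G.Adj] : ℕ := G.edgeFinset.card

/-- The (unsigned) discrepancy `|e₁ - e₀|` of the labeling in which exactly the
vertices of `S` are labeled `0`: `e₁ = φ(S)` and `e₀ = |E| - φ(S)`. -/
def cordDisc (G : SimpleGraph V) [DecidableRel G.Adj] (S : Finset V) : ℤ :=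
  |2 * (cutSize G S : ℤ) - (edgeCount G : ℤ)|

/-- The signed discrepancy `e₁ - e₀` of the labeling in which exactly the
vertices of `S` are labeled `0`. -/
def balDisc (G : SimpleGraph V) [DecidableRel G.Adj] (S : Finset V) : ℤ :=
  2 * (cutSize G S : ℤ) - (edgeCount G : ℤ)

/-- The min-max value of the vertex-selection game: Admirable (the minimizer)
and Impish (the maximizer) alternately select unselected vertices from `rem`
until none remain; `A` is the set of vertices selected by Admirable so far,
`turn = true` means it is Admirable's turn, and `p` is the number of times
Impish may still pass his turn.  The final payoff is `payoff A` where `A` is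
the set of all vertices Admirable selected.  `gameVal payoff p rem A turn ≤ k`
holds iff Admirable has a strategy guaranteeing payoff at most `k`, and
`gameVal payoff p rem A turn ≥ k` holds iff Impish has a strategy
guaranteeing payoff at least `k`. -/
def gameVal (payoff : Finset V → ℤ) (p : ℕ) (rem A : Finset V) (turn : Bool) : ℤ :=
  if hrem : rem.Nonempty then
    if turn then
      rem.attach.inf' (Finset.attach_nonempty_iff.mpr hrem)
        (fun v => gameVal payoff p (rem.erase v.1) (insert v.1 A) false)
    else
      let m := rem.attach.sup' (Finset.attach_nonempty_iff.mpr hrem)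
        (fun v => gameVal payoff p (rem.erase v.1) A true)
      if hp : p = 0 then m else max m (gameVal payoff (p - 1) rem A true)
  else payoff A
termination_by rem.card + p
decreasing_by
  · exact Nat.add_lt_add_right (Finset.card_erase_lt_of_mem v.2) p
  · exact Nat.add_lt_add_right (Finset.card_erase_lt_of_mem v.2) p
  · omega

/-- The game cordiality number `c_g(G)`: Admirable moves first. -/
def cg (G : SimpleGraph V) [DecidableRel G.Adj] : ℤ :=
  gameVal (cordDisc G) 0 univ ∅ true

/-- The Impish-start game cordiality number `c'_g(G)`. -/
def cg' (G : SimpleGraph V) [DecidableRel G.Adj] : ℤ :=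
  gameVal (cordDisc G) 0 univ ∅ false

/-- The Impish-start-with-pass game cordiality number `c*_g(G)`:
Impish moves first and may pass at most once. -/
def cgStar (G : SimpleGraph V) [DecidableRel G.Adj] : ℤ :=
  gameVal (cordDisc G) 1 univ ∅ false

/-- The game balance number `b_g(G)`: Admirable moves first, payoff is the
signed discrepancy `e₁ - e₀`. -/
def bg (G : SimpleGraph V) [DecidableRel G.Adj] : ℤ :=
  gameVal (balDisc G) 0 univ ∅ true

/-- The path `P_n` on vertices `v_1, …, v_n`, encoded as `0, …, n-1 : Fin n`. -/
def pathG (n : ℕ) : SimpleGraph (Fin n) :=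
  SimpleGraph.fromRel (fun i j => (i : ℕ) + 1 = (j : ℕ))

instance pathGDecidable (n : ℕ) : DecidableRel (pathG n).Adj :=
  fun a b => decidable_of_iff _ (SimpleGraph.fromRel_adj _ a b).symm

/-- The tree `B` on `v, v₁, v₂, v₃, v₄` (encoded as `0, 1, 2, 3, 4`) with
edges `vv₂, vv₃, v₁v₂, v₃v₄`. -/
def treeB : SimpleGraph (Fin 5) :=
  SimpleGraph.fromRel (fun a b =>
    (a = 0 ∧ b = 2) ∨ (a = 0 ∧ b = 3) ∨ (a = 1 ∧ b = 2) ∨ (a = 3 ∧ b = 4))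

instance : DecidableRel treeB.Adj :=
  fun a b => decidable_of_iff _ (SimpleGraph.fromRel_adj _ a b).symm

/-- The payoff of the restricted game on `B`: the worst discrepancy over the
two possible labels of the non-playable vertex `v = 0` (label `0` puts `v`
with Admirable's set `A`, label `1` leaves it out). -/
def payoffB (A : Finset (Fin 5)) : ℤ :=
  max (cordDisc treeB (insert 0 A)) (cordDisc treeB A)

/-- `Guarantees payoff k n p rem A turn` holds when Admirable, playing the position given by the
last four arguments, can force a final payoff of at most `k` within `n` further turns. -/
def Guarantees {α : Type} [DecidableEq α]
    (payoff : Finset α → ℤ) (k : ℤ) : ℕ → ℕ → Finset α → Finset α → Bool → Prop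
  | 0, _, rem, A, _ => rem = ∅ ∧ payoff A ≤ k
  | n + 1, p, rem, A, true =>
    if rem = ∅ then payoff A ≤ k
    else ∃ v ∈ rem, Guarantees payoff k n p (rem.erase v) (insert v A) false
  | n + 1, p, rem, A, false =>
    if rem = ∅ then payoff A ≤ k
    else (∀ v ∈ rem, Guarantees payoff k n p (rem.erase v) A true) ∧
      (p = 0 ∨ Guarantees payoff k n (p - 1) rem A true)

instance Guarantees.decidable {α : Type} [DecidableEq α]
    (payoff : Finset α → ℤ) (k : ℤ) :
    ∀ n p rem A turn, Decidable (Guarantees payoff k n p rem A turn)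
  | 0, _, _, _, _ => by unfold Guarantees; infer_instance
  | n + 1, p, rem, A, true => by
    have := Guarantees.decidable payoff k n
    unfold Guarantees; infer_instance
  | n + 1, p, rem, A, false => by
    have := Guarantees.decidable payoff k n
    unfold Guarantees; infer_instance

theorem gameVal_empty {α : Type} [DecidableEq α] (payoff : Finset α → ℤ) (p : ℕ)
    (A : Finset α) (turn : Bool) :
    gameVal payoff p ∅ A turn = payoff A := by
  rw [gameVal]; simp

theorem gameVal_true_le_iff {α : Type} [DecidableEq α]
    {payoff : Finset α → ℤ} {p : ℕ} {rem A : Finset α} {k : ℤ}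
    (hrem : rem.Nonempty) :
    gameVal payoff p rem A true ≤ k ↔
      ∃ v ∈ rem, gameVal payoff p (rem.erase v) (insert v A) false ≤ k := by
  rw [gameVal]; simp [hrem, Finset.inf'_le_iff]

theorem gameVal_false_le_iff {α : Type} [DecidableEq α]
    {payoff : Finset α → ℤ} {p : ℕ} {rem A : Finset α} {k : ℤ}
    (hrem : rem.Nonempty) :
    gameVal payoff p rem A false ≤ k ↔
      (∀ v ∈ rem, gameVal payoff p (rem.erase v) A true ≤ k) ∧
        (p = 0 ∨ gameVal payoff (p - 1) rem A true ≤ k) := by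
  rw [gameVal]
  by_cases hp : p = 0 <;> simp [hrem, hp, Finset.sup'_le_iff]

theorem Guarantees.gameVal_le {α : Type} [DecidableEq α]
    {payoff : Finset α → ℤ} {k : ℤ} {n p : ℕ}
    {rem A : Finset α} {turn : Bool} (h : Guarantees payoff k n p rem A turn) :
    gameVal payoff p rem A turn ≤ k := by
  induction n generalizing p rem A turn with
  | zero =>
    obtain ⟨rfl, hA⟩ := h
    rwa [gameVal_empty]
  | succ n ih =>
    rcases rem.eq_empty_or_nonempty with rfl | hrem
    · cases turn <;> simpa [Guarantees, gameVal_empty] using h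
    · cases turn
      · simp only [Guarantees, hrem.ne_empty, if_false] at h
        exact (gameVal_false_le_iff hrem).2 ⟨fun v hv => ih (h.1 v hv), h.2.imp_right ih⟩
      · simp only [Guarantees, hrem.ne_empty, if_false] at h
        obtain ⟨v, hv, hg⟩ := h
        exact (gameVal_true_le_iff hrem).2 ⟨v, hv, ih hg⟩

/-- in the cordiality game played on the playable vertices
`v₁, v₂, v₃, v₄` of `B`, in all three variants, Admirable can guarantee that
for either label of `v` the discrepancy over the edges of `B` is at most 2. -/
theorem treeB_discrepancy_two :
    gameVal payoffB 0 (univ.erase (0 : Fin 5)) ∅ true ≤ 2 ∧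
    gameVal payoffB 0 (univ.erase (0 : Fin 5)) ∅ false ≤ 2 ∧
    gameVal payoffB 1 (univ.erase (0 : Fin 5)) ∅ false ≤ 2 := by
  refine ⟨Guarantees.gameVal_le (n := 4) ?_, Guarantees.gameVal_le (n := 4) ?_,
    Guarantees.gameVal_le (n := 5) ?_⟩ <;> decide +kernel
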